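/- Let Ψ̄ be a real-valued function on 3×3 real matrices that is Fréchet differentiable, and let C be a symmetric 3×3 real matrix with det C > 0, J := √(det C), C̄ := J^(-2/3)·C. Write S̄ := 2·DΨ̄(C̄) (identifying the derivative with a matrix via the pairing A : B = trace(Aᵀ B)) and assume S̄ is symmetric. Then the map C ↦ Ψ̄(C̄(C)) is Fréchet differentiable at C and its derivative in direction H equals (1/2)·(S_isc : H), where S_isc := J^(-2/3)·Dev(S̄) := J^(-2/3)·(S̄ − (1/3)(S̄ : C)·C⁻¹). That is, the isochoric second Piola–Kirchhoff stress satisfies S_isc = 2·∂Ψ̄(C̄)/∂C = J^(-2/3)·Dev(S̄). -/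

import Mathlib

open Matrix

attribute [local instance] Matrix.normedAddCommGroup Matrix.normedSpace

theorem hasFDerivAt_det_poly_aux {V : Type*} [NormedAddCommGroup V] [NormedSpace ℝ V]
    (e : Fin 3 → Fin 3 → V → ℝ) (E : Fin 3 → Fin 3 → V →L[ℝ] ℝ) (x : V)
    (hE : ∀ i j, HasFDerivAt (e i j) (E i j) x)
    (hEe : ∀ i j h, E i j h = e i j h) :
    ∃ D : V →L[ℝ] ℝ,
      HasFDerivAt (fun y => e 0 0 y * e 1 1 y * e 2 2 y - e 0 0 y * e 1 2 y * e 2 1 y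
        - e 0 1 y * e 1 0 y * e 2 2 y + e 0 1 y * e 1 2 y * e 2 0 y
        + e 0 2 y * e 1 0 y * e 2 1 y - e 0 2 y * e 1 1 y * e 2 0 y) D x ∧
      ∀ h, D h = (e 1 1 x * e 2 2 x - e 1 2 x * e 2 1 x) * e 0 0 h
        + (e 1 2 x * e 2 0 x - e 1 0 x * e 2 2 x) * e 0 1 h
        + (e 1 0 x * e 2 1 x - e 1 1 x * e 2 0 x) * e 0 2 h
        + (e 0 2 x * e 2 1 x - e 0 1 x * e 2 2 x) * e 1 0 h
        + (e 0 0 x * e 2 2 x - e 0 2 x * e 2 0 x) * e 1 1 h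
        + (e 0 1 x * e 2 0 x - e 0 0 x * e 2 1 x) * e 1 2 h
        + (e 0 1 x * e 1 2 x - e 0 2 x * e 1 1 x) * e 2 0 h
        + (e 0 2 x * e 1 0 x - e 0 0 x * e 1 2 x) * e 2 1 h
        + (e 0 0 x * e 1 1 x - e 0 1 x * e 1 0 x) * e 2 2 h := by
  refine ⟨_, ((((((((hE 0 0).mul (hE 1 1)).mul (hE 2 2)).sub
    (((hE 0 0).mul (hE 1 2)).mul (hE 2 1))).sub
    (((hE 0 1).mul (hE 1 0)).mul (hE 2 2))).add
    (((hE 0 1).mul (hE 1 2)).mul (hE 2 0))).add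
    (((hE 0 2).mul (hE 1 0)).mul (hE 2 1))).sub
    (((hE 0 2).mul (hE 1 1)).mul (hE 2 0))), ?_⟩
  intro h
  simp [hEe]
  ring

theorem hasFDerivAt_comp_rpow_smul_aux {V : Type*} [NormedAddCommGroup V] [NormedSpace ℝ V]
    (Ψ : V → ℝ) (hΨ : Differentiable ℝ Ψ) (f : V → ℝ) (D : V →L[ℝ] ℝ) (x : V)
    (hD : HasFDerivAt f D x) (d : V → ℝ) (hd : ∀ h, D h = d h) (hx : 0 < f x) (p : ℝ) :
    ∃ L : V →L[ℝ] ℝ, HasFDerivAt (fun y => Ψ (f y ^ p • y)) L x ∧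
      ∀ h, L h = fderiv ℝ Ψ (f x ^ p • x) (f x ^ p • h + (p * f x ^ (p - 1) * d h) • x) := by
  have h1 := hD.rpow_const (p := p) (Or.inl hx.ne')
  have h2 : HasFDerivAt (fun y => f y ^ p • y) _ x := h1.smul (hasFDerivAt_id (𝕜 := ℝ) x)
  refine ⟨_, HasFDerivAt.comp (g := Ψ) x (hΨ (f x ^ p • x)).hasFDerivAt h2, ?_⟩
  intro h
  simp [hd]

theorem hasFDerivAt_det_three_aux (C : Matrix (Fin 3) (Fin 3) ℝ) :
    ∃ D : Matrix (Fin 3) (Fin 3) ℝ →L[ℝ] ℝ,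
      HasFDerivAt (fun M : Matrix (Fin 3) (Fin 3) ℝ => M.det) D C ∧
      ∀ H, D H = Matrix.trace (C.adjugate * H) := by
  have e : ∀ i j : Fin 3, ∃ E : Matrix (Fin 3) (Fin 3) ℝ →L[ℝ] ℝ,
      HasFDerivAt (fun M : Matrix (Fin 3) (Fin 3) ℝ => M i j) E C ∧ ∀ H, E H = H i j := by
    intro i j
    let E := LinearMap.toContinuousLinearMap (Matrix.entryLinearMap ℝ ℝ i j :
      Matrix (Fin 3) (Fin 3) ℝ →ₗ[ℝ] ℝ)
    exact ⟨E, E.hasFDerivAt, fun H => rfl⟩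
  choose E hE hEH using e
  obtain ⟨D, hD, hDH⟩ := hasFDerivAt_det_poly_aux
    (fun i j (M : Matrix (Fin 3) (Fin 3) ℝ) => M i j) E C hE hEH
  simp only [Matrix.det_fin_three]
  refine ⟨D, hD, ?_⟩
  intro H
  refine (hDH H).trans ?_
  simp only [Matrix.adjugate_fin_three, Matrix.trace_fin_three, Matrix.mul_apply,
    Fin.sum_univ_three]
  simp
  ring

/-- **The isochoric second Piola–Kirchhoff stress `S_isc = 2·∂Ψ̄(C̄)/∂C = J^(-2/3)·Dev(S̄)`.**
Let `Ψ̄` be a Fréchet differentiable real-valued function on 3×3 matrices, `C` a symmetric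
3×3 matrix with `det C > 0`, `J := √(det C)`, `C̄ := J^(-2/3) • C`, and let `S̄` be the
symmetric matrix identified with `2·DΨ̄(C̄)` via the pairing `A : B = trace (Aᵀ * B)`.
Then `M ↦ Ψ̄((det M)^(-1/3) • M)` is Fréchet differentiable at `C` with derivative
`H ↦ (1/2)·(S_isc : H)` where `S_isc := J^(-2/3) • (S̄ − (1/3)(S̄ : C) • C⁻¹)`. -/
theorem hasFDerivAt_isochoric_strain_energy
    (Ψ : Matrix (Fin 3) (Fin 3) ℝ → ℝ) (hΨ : Differentiable ℝ Ψ)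
    (C : Matrix (Fin 3) (Fin 3) ℝ) (hCsym : Cᵀ = C) (hC : 0 < C.det)
    (J : ℝ) (hJ : J = Real.sqrt C.det)
    (Cbar : Matrix (Fin 3) (Fin 3) ℝ) (hCbar : Cbar = J ^ (-(2 : ℝ) / 3) • C)
    (Sbar : Matrix (Fin 3) (Fin 3) ℝ) (hSsym : Sbarᵀ = Sbar)
    (hSbar : ∀ H : Matrix (Fin 3) (Fin 3) ℝ,
      fderiv ℝ Ψ Cbar H = (1 / 2) * Matrix.trace (Sbarᵀ * H)) :
    ∃ L : Matrix (Fin 3) (Fin 3) ℝ →L[ℝ] ℝ,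
      HasFDerivAt
        (fun M : Matrix (Fin 3) (Fin 3) ℝ => Ψ (M.det ^ (-(1 : ℝ) / 3) • M)) L C ∧
      ∀ H : Matrix (Fin 3) (Fin 3) ℝ,
        L H = (1 / 2) * Matrix.trace
          ((J ^ (-(2 : ℝ) / 3) •
            (Sbar - (((1 : ℝ) / 3) * Matrix.trace (Sbarᵀ * C)) • C⁻¹))ᵀ * H) := by
  obtain ⟨D, hD, hDH⟩ := hasFDerivAt_det_three_aux C
  have hJp : J ^ (-(2 : ℝ) / 3) = C.det ^ (-(1 : ℝ) / 3) := by
    rw [hJ, Real.sqrt_eq_rpow, ← Real.rpow_mul hC.le]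
    norm_num
  obtain ⟨L, hL, hLH⟩ := hasFDerivAt_comp_rpow_smul_aux Ψ hΨ
    (fun M : Matrix (Fin 3) (Fin 3) ℝ => M.det) D C hD
    (fun H => Matrix.trace (C.adjugate * H)) hDH hC (-(1 : ℝ) / 3)
  refine ⟨L, hL, ?_⟩
  intro H
  rw [hJp] at hCbar
  subst hCbar
  refine (hLH H).trans ((hSbar _).trans ?_)
  have hinv : C⁻¹ᵀ = C⁻¹ := by rw [Matrix.transpose_nonsing_inv, hCsym]
  have hadj : C⁻¹ = C.det⁻¹ • C.adjugate := by
    rw [Matrix.inv_def, Ring.inverse_eq_inv']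
  have hpow : C.det ^ (-(1 : ℝ) / 3 - 1) = C.det ^ (-(1 : ℝ) / 3) * C.det⁻¹ := by
    rw [Real.rpow_sub_one hC.ne', div_eq_mul_inv]
  rw [hJp, Matrix.transpose_smul, Matrix.transpose_sub, Matrix.transpose_smul, hinv, hadj]
  simp [hpow, Matrix.sub_mul, Matrix.mul_add]
  ring
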